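/- Let A = (r,c,t) and B = (r',c',t') be distinct Garnir nodes of an l-multipartition λ of n, and let g^{A,B} be the join of g^A and g^B, i.e. the unique ≥_L-least row-strict λ-tableau that is ≥_L both g^A and g^B. Then: (1) if the Garnir belts B^A and B^B are disjoint, then w^{g^{A,B}} is fully commutative (equivalently 321-avoiding); (2) if r = r' and t = t', then w^{g^{A,B}} is fully commutative (321-avoiding); (3) if w^A, w^B ∈ S_n satisfy g^{A,B} = w^A g^A = w^B g^B, then w^A and w^B are fully commutative (321-avoiding). -/

import Mathlib

/-- A node `(r, c, t)` of (the Young diagram of) an `l`-multipartition: row `r`,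
column `c`, component `t`, all 1-based. -/
abbrev MNode : Type := ℕ × ℕ × ℕ

/-- The simple transposition `sᵢ = (i, i+1)`. -/
def sgen (i : ℕ) : Equiv.Perm ℕ := Equiv.swap i (i + 1)

/-- The Coxeter length of a permutation supported on `{1, …, n}`:
its number of inversions among `1, …, n`. -/
def invLen (n : ℕ) (w : Equiv.Perm ℕ) : ℕ :=
  ((Finset.Icc 1 n ×ˢ Finset.Icc 1 n).filter fun p => p.1 < p.2 ∧ w p.2 < w p.1).card

/-- `w` fixes every letter outside `{1, …, n}` (i.e. `w ∈ S_n`). -/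
def FixOut (n : ℕ) (w : Equiv.Perm ℕ) : Prop := ∀ m, m ∉ Set.Icc 1 n → w m = m

namespace MP

/-- `lam t r` is the length `λ^(t)_r` of the `r`-th row (1-based) of the `t`-th component
of an `l`-multipartition of `n`: each component is weakly decreasing, rows beyond the `n`-th
are empty, each row has length at most `n`, and the total number of boxes is `n`. -/
def IsMP (l n : ℕ) (lam : ℕ → ℕ → ℕ) : Prop :=
  (∀ t r, 1 ≤ r → lam t (r + 1) ≤ lam t r) ∧
  (∀ t r, n < r → lam t r = 0) ∧
  (∀ t r, lam t r ≤ n) ∧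
  (∑ t ∈ Finset.Icc 1 l, ∑ r ∈ Finset.Icc 1 n, lam t r) = n

/-- The Young diagram `[λ]` of the multipartition. -/
def diag (l : ℕ) (lam : ℕ → ℕ → ℕ) : Set MNode :=
  {x | 1 ≤ x.1 ∧ 1 ≤ x.2.1 ∧ 1 ≤ x.2.2 ∧ x.2.2 ≤ l ∧ x.2.1 ≤ lam x.2.2 x.1}

/-- A `λ`-tableau: a bijection `[λ] → {1, …, n}`. -/
def IsTab (l n : ℕ) (lam : ℕ → ℕ → ℕ) (T : MNode → ℕ) : Prop :=
  Set.BijOn T (diag l lam) (Set.Icc 1 n)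

/-- Entries increase from left to right along the rows of each component. -/
def RowStrict (l : ℕ) (lam : ℕ → ℕ → ℕ) (T : MNode → ℕ) : Prop :=
  ∀ r c t, (r, c, t) ∈ diag l lam → (r, c + 1, t) ∈ diag l lam →
    T (r, c, t) < T (r, c + 1, t)

/-- Entries increase down the columns of each component. -/
def ColStrict (l : ℕ) (lam : ℕ → ℕ → ℕ) (T : MNode → ℕ) : Prop :=
  ∀ r c t, (r, c, t) ∈ diag l lam → (r + 1, c, t) ∈ diag l lam →
    T (r, c, t) < T (r + 1, c, t)

/-- A standard `λ`-tableau. -/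
def IsStd (l n : ℕ) (lam : ℕ → ℕ → ℕ) (T : MNode → ℕ) : Prop :=
  IsTab l n lam T ∧ RowStrict l lam T ∧ ColStrict l lam T

/-- The initial tableau `t^λ`, filling `1, …, n` along successive rows of `λ^(1)`,
then of `λ^(2)`, and so on. -/
def itab (n : ℕ) (lam : ℕ → ℕ → ℕ) (x : MNode) : ℕ :=
  (∑ t' ∈ Finset.Ico 1 x.2.2, ∑ r' ∈ Finset.Icc 1 n, lam t' r') +
  (∑ r' ∈ Finset.Ico 1 x.1, lam x.2.2 r') + x.2.1

/-- `(r, c, t)` is a Garnir node of `[λ]`. -/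
def IsGarnir (l : ℕ) (lam : ℕ → ℕ → ℕ) (r c t : ℕ) : Prop :=
  (r, c, t) ∈ diag l lam ∧ (r + 1, c, t) ∈ diag l lam

/-- The Garnir belt `B^A` of the Garnir node `A = (r, c, t)`. -/
def belt (lam : ℕ → ℕ → ℕ) (r c t : ℕ) : Set MNode :=
  {x | (x.1 = r ∧ x.2.2 = t ∧ c ≤ x.2.1 ∧ x.2.1 ≤ lam t r) ∨
       (x.1 = r + 1 ∧ x.2.2 = t ∧ 1 ≤ x.2.1 ∧ x.2.1 ≤ c)}

/-- The Garnir tableau `g^A` of the Garnir node `A = (r, c, t)`: it agrees with `t^λ`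
outside the Garnir belt, and the entries `u, …, v` (`u = t^λ(r,c,t)`, `v = t^λ(r+1,c,t)`)
fill the belt in increasing order, first along row `r+1` and then along row `r`,
each from left to right. -/
def gtab (n : ℕ) (lam : ℕ → ℕ → ℕ) (r c t : ℕ) : MNode → ℕ := fun x =>
  if x.1 = r + 1 ∧ x.2.2 = t ∧ 1 ≤ x.2.1 ∧ x.2.1 ≤ c then
    itab n lam (r, c, t) + (x.2.1 - 1)
  else if x.1 = r ∧ x.2.2 = t ∧ c ≤ x.2.1 then
    itab n lam (r, c, t) + c + (x.2.1 - c)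
  else itab n lam x

/-- `w` is the permutation `w^T` associated to the tableau `T`, i.e. `w ∈ S_n`
and `w t^λ = T`. -/
def PermOf (l n : ℕ) (lam : ℕ → ℕ → ℕ) (T : MNode → ℕ) (w : Equiv.Perm ℕ) : Prop :=
  FixOut n w ∧ ∀ x ∈ diag l lam, w (itab n lam x) = T x

/-- The left (weak Bruhat) order: `v ≥_L w` iff `v = u w` with `ℓ(v) = ℓ(u) + ℓ(w)`. -/
def LeftGe (n : ℕ) (v w : Equiv.Perm ℕ) : Prop :=
  ∃ u : Equiv.Perm ℕ, FixOut n u ∧ v = u * w ∧ invLen n v = invLen n u + invLen n w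

/-- The left order on `λ`-tableaux: `T ≥_L T'` iff `w^T ≥_L w^{T'}`. -/
def TabGe (l n : ℕ) (lam : ℕ → ℕ → ℕ) (T T' : MNode → ℕ) : Prop :=
  ∃ wT wT' : Equiv.Perm ℕ, PermOf l n lam T wT ∧ PermOf l n lam T' wT' ∧ LeftGe n wT wT'

end MP

open MP

/-- `w` is 321-avoiding (equivalently, fully commutative) as an element of `S_n`. -/
def Avoids321 (n : ℕ) (w : Equiv.Perm ℕ) : Prop :=
  ∀ i j m : ℕ, 1 ≤ i → i < j → j < m → m ≤ n → w j < w i → w m < w j → False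

/-- `G` is the join `g^A ∨ g^B` of the two Garnir tableaux: the `≥_L`-least
row-strict `λ`-tableau that is `≥_L` both of them. -/
def IsJoin (l n : ℕ) (lam : ℕ → ℕ → ℕ) (r c t r' c' t' : ℕ) (G : MNode → ℕ) : Prop :=
  IsTab l n lam G ∧ RowStrict l lam G ∧
  TabGe l n lam G (gtab n lam r c t) ∧ TabGe l n lam G (gtab n lam r' c' t') ∧
  (∀ T : MNode → ℕ, IsTab l n lam T → RowStrict l lam T →
    TabGe l n lam T (gtab n lam r c t) → TabGe l n lam T (gtab n lam r' c' t') →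
    TabGe l n lam T G)

theorem FixOut.mem_Icc_iff {n : ℕ} {w : Equiv.Perm ℕ} (hw : FixOut n w) (i : ℕ) :
    w i ∈ Set.Icc 1 n ↔ i ∈ Set.Icc 1 n := by
  constructor
  · intro h
    by_contra hi
    exact hi (hw i hi ▸ h)
  · intro h
    by_contra hi
    exact hi ((w.injective (hw _ hi)).symm ▸ h)

theorem FixOut.symm {n : ℕ} {w : Equiv.Perm ℕ} (hw : FixOut n w) : FixOut n w.symm := by
  intro i hi
  rw [Equiv.symm_apply_eq, hw i hi]

theorem FixOut.mul {n : ℕ} {u w : Equiv.Perm ℕ} (hu : FixOut n u) (hw : FixOut n w) :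
    FixOut n (u * w) := by
  intro i hi
  rw [Equiv.Perm.mul_apply, hw i hi, hu i hi]

/-- The length of `u` counts the pairs `i < j` for which `u` reverses the order of `w i`
and `w j`. -/
theorem invLen_eq_card_reversed {n : ℕ} {u w : Equiv.Perm ℕ} (hw : FixOut n w) :
    invLen n u = ((Finset.Icc 1 n ×ˢ Finset.Icc 1 n).filter fun p => p.1 < p.2 ∧
      (w p.1 < w p.2 ∧ u (w p.2) < u (w p.1) ∨
        w p.2 < w p.1 ∧ u (w p.1) < u (w p.2))).card := by
  have hmem := hw.mem_Icc_iff
  have hmem' := hw.symm.mem_Icc_iff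
  simp only [Set.mem_Icc] at hmem hmem'
  symm
  refine Finset.card_bij' (fun p _ => (min (w p.1) (w p.2), max (w p.1) (w p.2)))
    (fun q _ => (min (w.symm q.1) (w.symm q.2), max (w.symm q.1) (w.symm q.2))) ?_ ?_ ?_ ?_
  · rintro ⟨i, j⟩ h
    simp only [Finset.mem_filter, Finset.mem_product, Finset.mem_Icc] at h ⊢
    have h1 := (hmem i).2 h.1.1
    have h2 := (hmem j).2 h.1.2
    rcases h.2.2 with h3 | h3
    · simp only [min_eq_left h3.1.le, max_eq_right h3.1.le]
      exact ⟨⟨h1, h2⟩, h3⟩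
    · simp only [min_eq_right h3.1.le, max_eq_left h3.1.le]
      exact ⟨⟨h2, h1⟩, h3⟩
  · rintro ⟨p, q⟩ h
    simp only [Finset.mem_filter, Finset.mem_product, Finset.mem_Icc] at h ⊢
    have h1 := (hmem' p).2 h.1.1
    have h2 := (hmem' q).2 h.1.2
    rcases lt_trichotomy (w.symm p) (w.symm q) with h3 | h3 | h3
    · simp only [min_eq_left h3.le, max_eq_right h3.le, Equiv.apply_symm_apply]
      exact ⟨⟨h1, h2⟩, h3, Or.inl h.2⟩
    · exact absurd (w.symm.injective h3) h.2.1.ne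
    · simp only [min_eq_right h3.le, max_eq_left h3.le, Equiv.apply_symm_apply]
      exact ⟨⟨h2, h1⟩, h3, Or.inr h.2⟩
  · rintro ⟨i, j⟩ h
    simp only [Finset.mem_filter, Finset.mem_product, Finset.mem_Icc] at h ⊢
    rcases h.2.2 with h3 | h3
    · simp [min_eq_left h3.1.le, max_eq_right h3.1.le, h.2.1.le]
    · simp [min_eq_right h3.1.le, max_eq_left h3.1.le, h.2.1.le]
  · rintro ⟨p, q⟩ h
    simp only [Finset.mem_filter, Finset.mem_product, Finset.mem_Icc] at h ⊢
    rcases le_total (w.symm p) (w.symm q) with h3 | h3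
    · simp [min_eq_left h3, max_eq_right h3, h.2.1.le]
    · simp [min_eq_right h3, max_eq_left h3, h.2.1.le]

/-- The left order is containment of inversion sets. -/
theorem leftGe_iff {n : ℕ} {v w : Equiv.Perm ℕ} (hv : FixOut n v) (hw : FixOut n w) :
    LeftGe n v w ↔ ∀ i j, 1 ≤ i → i < j → j ≤ n → w j < w i → v j < v i := by
  have key : ∀ u : Equiv.Perm ℕ, v = u * w → (invLen n v = invLen n u + invLen n w ↔
      ∀ i j, 1 ≤ i → i < j → j ≤ n → w j < w i → v j < v i) := by
    rintro u rfl
    simp only [Equiv.Perm.mul_apply]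
    set P := Finset.Icc 1 n ×ˢ Finset.Icc 1 n with hP
    set A := P.filter fun p => p.1 < p.2 ∧ w p.2 < w p.1 with hA
    set B := P.filter fun p => p.1 < p.2 ∧ (w p.1 < w p.2 ∧ u (w p.2) < u (w p.1) ∨
        w p.2 < w p.1 ∧ u (w p.1) < u (w p.2)) with hB
    have hV : (P.filter fun p => p.1 < p.2 ∧ u (w p.2) < u (w p.1)) = (B \ A) ∪ (A \ B) := by
      ext ⟨i, j⟩
      simp only [hA, hB, Finset.mem_union, Finset.mem_sdiff, Finset.mem_filter]
      have h1 : w i = w j → i = j := fun h => w.injective h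
      have h2 : u (w i) = u (w j) → i = j := fun h => w.injective (u.injective h)
      grind
    have hcard : invLen n u + invLen n w = B.card + A.card := by
      rw [invLen_eq_card_reversed (u := u) hw]
      rfl
    have hlen : invLen n (u * w) = ((B \ A) ∪ (A \ B)).card := by
      rw [← hV]
      rfl
    rw [hlen, hcard, Finset.card_union_of_disjoint (disjoint_sdiff_sdiff)]
    have e1 := Finset.card_sdiff_add_card_inter B A
    have e2 := Finset.card_sdiff_add_card_inter A B
    rw [Finset.inter_comm] at e2
    have e3 : (B \ A).card + (A \ B).card = B.card + A.card ↔ B ∩ A = ∅ := by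
      rw [← Finset.card_eq_zero]
      omega
    rw [e3, Finset.eq_empty_iff_forall_notMem]
    constructor
    · intro h i j hi hij hj hwij
      by_contra hc
      refine h (i, j) ?_
      have h2 : u (w i) = u (w j) → i = j := fun h => w.injective (u.injective h)
      simp only [hA, hB, hP, Finset.mem_inter, Finset.mem_filter, Finset.mem_product,
        Finset.mem_Icc]
      grind
    · rintro h ⟨i, j⟩ hm
      simp only [hA, hB, hP, Finset.mem_inter, Finset.mem_filter, Finset.mem_product,
        Finset.mem_Icc] at hm
      have := h i j hm.1.1.1.1 hm.2.2.1 hm.1.1.2.2 hm.2.2.2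
      omega
  constructor
  · rintro ⟨u, -, huv, hlen⟩
    exact (key u huv).1 hlen
  · intro h
    have hvw : v = v * w.symm * w := by
      ext i
      simp
    exact ⟨v * w.symm, hv.mul hw.symm, hvw, (key _ hvw).2 h⟩

/-- A relation that is transitive, with transitive complement, on increasing pairs is the
inversion set of a permutation. -/
theorem exists_perm_of_inversions (n : ℕ) (S : ℕ → ℕ → Prop)
    (htrans : ∀ i j k, i < j → j < k → S i j → S j k → S i k)
    (hcotrans : ∀ i j k, i < j → j < k → S i k → S i j ∨ S j k) :
    ∃ w : Equiv.Perm ℕ, FixOut n w ∧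
      ∀ i j, 1 ≤ i → i < j → j ≤ n → (w j < w i ↔ S i j) := by
  classical
  set R : ℕ → ℕ → Prop := fun a b => (a < b ∧ ¬ S a b) ∨ (b < a ∧ S b a) with hR
  have hRirr : ∀ a, ¬ R a a := by simp [hR]
  have hRtrans : ∀ a b c, R a b → R b c → R a c := by
    intro a b c hab hbc
    have h1 := htrans a b c
    have h2 := htrans a c b
    have h3 := htrans b a c
    have h4 := htrans b c a
    have h5 := htrans c a b
    have h6 := htrans c b a
    have g1 := hcotrans a b c
    have g2 := hcotrans a c b
    have g3 := hcotrans b a c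
    have g4 := hcotrans b c a
    have g5 := hcotrans c a b
    have g6 := hcotrans c b a
    simp only [hR] at *
    rcases lt_trichotomy a c with h | h | h
    · grind
    · subst h; grind
    · grind
  have hRtot : ∀ a b, a < b → R a b ∨ R b a := by
    intro a b hab
    simp only [hR]
    tauto
  set f : ℕ → ℕ := fun i => if i ∈ Finset.Icc 1 n then
    ((Finset.Icc 1 n).filter fun j => R j i).card + 1 else i with hf
  have hlt : ∀ a ∈ Finset.Icc 1 n, ∀ b ∈ Finset.Icc 1 n, R a b → f a < f b := by
    intro a ha b hb hab
    simp only [hf, ha, hb, if_true, add_lt_add_iff_right]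
    refine Finset.card_lt_card ?_
    rw [Finset.ssubset_iff_of_subset]
    · exact ⟨a, by simp_all, by simp [hRirr]⟩
    · intro x hx
      rw [Finset.mem_filter] at hx ⊢
      exact ⟨hx.1, hRtrans _ _ _ hx.2 hab⟩
  have hmaps : ∀ a ∈ Finset.Icc 1 n, f a ∈ Finset.Icc 1 n := by
    intro a ha
    have hcard : ((Finset.Icc 1 n).filter fun j => R j a).card < (Finset.Icc 1 n).card := by
      refine Finset.card_lt_card ?_
      rw [Finset.ssubset_iff_of_subset (Finset.filter_subset _ _)]
      exact ⟨a, ha, by simp [hRirr]⟩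
    rw [Nat.card_Icc] at hcard
    simp only [hf, if_pos ha]
    rw [Finset.mem_Icc]
    omega
  have hinj : Set.InjOn f (Finset.Icc 1 n) := by
    intro a ha b hb hab
    by_contra hne
    have : R a b ∨ R b a := by
      rcases lt_or_gt_of_ne hne with h | h
      · exact hRtot a b h
      · exact (hRtot b a h).symm
    rcases this with h | h
    · exact (hlt a ha b hb h).ne hab
    · exact (hlt b hb a ha h).ne' hab
  have hsurj := Finset.surjOn_of_injOn_of_card_le f hmaps hinj le_rfl
  have hout : ∀ a, a ∉ Finset.Icc 1 n → f a = a := fun a ha => by simp only [hf, ha, if_false]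
  have hbij : Function.Bijective f := by
    constructor
    · intro a b hab
      by_cases ha : a ∈ Finset.Icc 1 n <;> by_cases hb : b ∈ Finset.Icc 1 n
      · exact hinj ha hb hab
      · exact absurd (hout b hb ▸ hab ▸ hmaps a ha) hb
      · exact absurd (hout a ha ▸ hab.symm ▸ hmaps b hb) ha
      · rw [← hout a ha, hab, hout b hb]
    · intro b
      by_cases hb : b ∈ Finset.Icc 1 n
      · obtain ⟨a, -, ha⟩ := hsurj hb
        exact ⟨a, ha⟩
      · exact ⟨b, hout b hb⟩
  refine ⟨Equiv.ofBijective f hbij, fun m hm => hout m (by simpa using hm), ?_⟩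
  intro i j hi hij hj
  have hi' : i ∈ Finset.Icc 1 n := by simp; omega
  have hj' : j ∈ Finset.Icc 1 n := by simp; omega
  rw [Equiv.ofBijective_apply, Equiv.ofBijective_apply]
  constructor
  · intro h
    by_contra hS
    exact (hlt i hi' j hj' (Or.inl ⟨hij, hS⟩)).not_gt h
  · intro hS
    exact hlt j hj' i hi' (Or.inr ⟨hij, hS⟩)

theorem avoids321_of_inversions {n : ℕ} {w : Equiv.Perm ℕ} (S : ℕ → ℕ → Prop)
    (hS : ∀ i j, 1 ≤ i → i < j → j ≤ n → w j < w i → S i j)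
    (hchain : ∀ i j k, S i j → S j k → False) : Avoids321 n w := by
  intro i j k hi hij hjk hk h1 h2
  exact hchain i j k (hS i j hi hij (by omega) h1) (hS j k (by omega) hjk hk h2)

/-- If `v = u w` lies above `w` in the left order, a 321-pattern of `u` comes from a chain
of inversions of `v` none of which is an inversion of `w`. -/
theorem avoids321_of_left_factor {n : ℕ} {u v w : Equiv.Perm ℕ} (hw : FixOut n w)
    (hv : ∀ i, 1 ≤ i → i ≤ n → v i = u (w i))
    (hle : ∀ i j, 1 ≤ i → i < j → j ≤ n → w j < w i → v j < v i)
    (hchain : ∀ i j k, 1 ≤ i → i < j → j < k → k ≤ n → v j < v i → v k < v j →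
      w i < w j → w j < w k → False) : Avoids321 n u := by
  intro p q s hp hpq hqs hs h1 h2
  have hmem := hw.symm.mem_Icc_iff
  simp only [Set.mem_Icc] at hmem
  have hmono : ∀ a b, 1 ≤ a → a < b → b ≤ n → u b < u a → w.symm a < w.symm b := by
    intro a b ha hab hb hu
    have hma := (hmem a).2 (by omega)
    have hmb := (hmem b).2 (by omega)
    rcases lt_trichotomy (w.symm a) (w.symm b) with h | h | h
    · exact h
    · exact absurd (w.symm.injective h) hab.ne
    · have := hle _ _ hmb.1 h hma.2 (by simpa using hab)
      rw [hv _ hma.1 hma.2, hv _ hmb.1 hmb.2] at this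
      simp only [Equiv.apply_symm_apply] at this
      omega
  have hmp := (hmem p).2 (by omega)
  have hmq := (hmem q).2 (by omega)
  have hms := (hmem s).2 (by omega)
  refine hchain (w.symm p) (w.symm q) (w.symm s) hmp.1 (hmono p q hp hpq (by omega) h1)
    (hmono q s (by omega) hqs hs h2) hms.2 ?_ ?_ (by simpa using hpq) (by simpa using hqs)
  · rw [hv _ hmp.1 hmp.2, hv _ hmq.1 hmq.2]
    simpa using h1
  · rw [hv _ hms.1 hms.2, hv _ hmq.1 hmq.2]
    simpa using h2

/-- The inversion relation exchanging the consecutive blocks `[u, m)` and `[m, v]`. -/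
def BlockInv (u m v i j : ℕ) : Prop := u ≤ i ∧ i < m ∧ m ≤ j ∧ j ≤ v

section Tableaux

variable {l n : ℕ} {lam : ℕ → ℕ → ℕ}

theorem itab_eq_add (r c t : ℕ) : itab n lam (r, c, t) = itab n lam (r, 0, t) + c := by
  simp [itab]

theorem itab_succ_row {r : ℕ} (hr : 1 ≤ r) (t : ℕ) :
    itab n lam (r + 1, 0, t) = itab n lam (r, 0, t) + lam t r := by
  simp only [itab, Finset.sum_Ico_succ_top hr]
  omega

theorem bijOn_itab {T : MNode → ℕ} {w : Equiv.Perm ℕ} (hT : IsTab l n lam T)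
    (hw : PermOf l n lam T w) : Set.BijOn (itab n lam) (diag l lam) (Set.Icc 1 n) := by
  have hcomp : ∀ x ∈ diag l lam, itab n lam x = w.symm (T x) := fun x hx => by
    rw [← hw.2 x hx, Equiv.symm_apply_apply]
  refine Set.BijOn.congr (f₁ := fun x => w.symm (T x)) ?_ fun x hx => (hcomp x hx).symm
  refine Set.BijOn.comp (g := w.symm) (t := Set.Icc 1 n) ?_ hT
  exact Equiv.bijOn _ fun i => (hw.1.symm).mem_Icc_iff i

theorem mem_belt_iff (hbij : Set.BijOn (itab n lam) (diag l lam) (Set.Icc 1 n)) {r c t : ℕ}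
    (hA : IsGarnir l lam r c t) {x : MNode} (hx : x ∈ diag l lam) :
    ((x.1 = r + 1 ∧ x.2.2 = t ∧ 1 ≤ x.2.1 ∧ x.2.1 ≤ c) ↔
      itab n lam (r + 1, 1, t) ≤ itab n lam x ∧ itab n lam x ≤ itab n lam (r + 1, c, t)) ∧
    ((x.1 = r ∧ x.2.2 = t ∧ c ≤ x.2.1) ↔
      itab n lam (r, c, t) ≤ itab n lam x ∧ itab n lam x < itab n lam (r + 1, 1, t)) := by
  obtain ⟨⟨h1, h2, h3, h4, h5⟩, -, -, -, -, h6⟩ := hA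
  obtain ⟨a, b, s⟩ := x
  have hrow := itab_succ_row (n := n) (lam := lam) h1 t
  have e1 := itab_eq_add (n := n) (lam := lam) r c t
  have e2 := itab_eq_add (n := n) (lam := lam) (r + 1) c t
  have e3 := itab_eq_add (n := n) (lam := lam) (r + 1) 1 t
  dsimp only at *
  constructor
  · constructor
    · rintro ⟨rfl, rfl, hb, hb'⟩
      have := itab_eq_add (n := n) (lam := lam) (r + 1) b s
      omega
    · rintro ⟨ha, hb⟩
      obtain ⟨d, hd⟩ := Nat.exists_eq_add_of_le ha
      have e4 := itab_eq_add (n := n) (lam := lam) (r + 1) (d + 1) t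
      have := hbij.injOn hx (x₂ := (r + 1, d + 1, t))
        ⟨by simp, by simp, h3, h4, by dsimp only; omega⟩ (by omega)
      simp only [Prod.mk.injEq] at this
      omega
  · constructor
    · rintro ⟨rfl, rfl, hb⟩
      have := itab_eq_add (n := n) (lam := lam) a b s
      have : b ≤ lam s a := hx.2.2.2.2
      omega
    · rintro ⟨ha, hb⟩
      obtain ⟨d, hd⟩ := Nat.exists_eq_add_of_le ha
      have e4 := itab_eq_add (n := n) (lam := lam) r (c + d) t
      have := hbij.injOn hx (x₂ := (r, c + d, t))
        ⟨h1, by dsimp only; omega, h3, h4, by dsimp only; omega⟩ (by omega)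
      simp only [Prod.mk.injEq] at this
      omega

theorem itab_garnir_lt {r c t : ℕ} (hA : IsGarnir l lam r c t) :
    itab n lam (r, c, t) < itab n lam (r + 1, 1, t) ∧
      itab n lam (r + 1, 1, t) ≤ itab n lam (r + 1, c, t) := by
  obtain ⟨⟨h1, h2, h3, h4, h5⟩, -, -, -, -, h6⟩ := hA
  have hrow := itab_succ_row (n := n) (lam := lam) h1 t
  have e1 := itab_eq_add (n := n) (lam := lam) r c t
  have e2 := itab_eq_add (n := n) (lam := lam) (r + 1) c t
  have e3 := itab_eq_add (n := n) (lam := lam) (r + 1) 1 t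
  dsimp only at *
  omega

theorem gtab_eq (hbij : Set.BijOn (itab n lam) (diag l lam) (Set.Icc 1 n)) {r c t : ℕ}
    (hA : IsGarnir l lam r c t) {x : MNode} (hx : x ∈ diag l lam) {u m v i : ℕ}
    (hu : u = itab n lam (r, c, t)) (hm : m = itab n lam (r + 1, 1, t))
    (hv : v = itab n lam (r + 1, c, t)) (hi : i = itab n lam x) :
    gtab n lam r c t x = if m ≤ i ∧ i ≤ v then u + (i - m)
      else if u ≤ i ∧ i < m then i + (v + 1 - m) else i := by
  obtain ⟨hY, hX⟩ := mem_belt_iff hbij hA hx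
  subst hu hm hv hi
  unfold gtab
  simp only [← hY, ← hX]
  obtain ⟨a, b, s⟩ := x
  have e1 := itab_eq_add (n := n) (lam := lam) r c t
  have e2 := itab_eq_add (n := n) (lam := lam) (r + 1) c t
  have e3 := itab_eq_add (n := n) (lam := lam) (r + 1) 1 t
  have e4 := itab_eq_add (n := n) (lam := lam) a b s
  dsimp only at *
  split_ifs with h1 h2
  · obtain ⟨rfl, rfl, -, -⟩ := h1
    omega
  · obtain ⟨rfl, rfl, hb⟩ := h2
    omega
  · rfl

theorem gtab_inversions (hbij : Set.BijOn (itab n lam) (diag l lam) (Set.Icc 1 n))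
    {r c t : ℕ} (hA : IsGarnir l lam r c t) {w : Equiv.Perm ℕ}
    (hw : PermOf l n lam (gtab n lam r c t) w) {i j : ℕ} (hi : 1 ≤ i) (hij : i < j)
    (hj : j ≤ n) : w j < w i ↔ BlockInv (itab n lam (r, c, t)) (itab n lam (r + 1, 1, t))
      (itab n lam (r + 1, c, t)) i j := by
  obtain ⟨x, hx, rfl⟩ := hbij.surjOn (show i ∈ Set.Icc 1 n from ⟨hi, by omega⟩)
  obtain ⟨y, hy, rfl⟩ := hbij.surjOn (show j ∈ Set.Icc 1 n from ⟨by omega, hj⟩)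
  rw [hw.2 x hx, hw.2 y hy, gtab_eq hbij hA hx rfl rfl rfl rfl,
    gtab_eq hbij hA hy rfl rfl rfl rfl]
  have := itab_garnir_lt (n := n) hA
  unfold BlockInv
  split_ifs <;> omega

/-- The inversions of the join are contained in any inversion set that contains those of both
Garnir tableaux and does not reverse neighbours within a row. -/
theorem join_inversions_le {r c t r' c' t' : ℕ}
    (hA : IsGarnir l lam r c t) (hB : IsGarnir l lam r' c' t') {G : MNode → ℕ}
    (hG : IsJoin l n lam r c t r' c' t' G) {w : Equiv.Perm ℕ} (hw : PermOf l n lam G w)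
    (S : ℕ → ℕ → Prop)
    (htrans : ∀ i j k, i < j → j < k → S i j → S j k → S i k)
    (hcotrans : ∀ i j k, i < j → j < k → S i k → S i j ∨ S j k)
    (hSA : ∀ i j, BlockInv (itab n lam (r, c, t)) (itab n lam (r + 1, 1, t))
      (itab n lam (r + 1, c, t)) i j → S i j)
    (hSB : ∀ i j, BlockInv (itab n lam (r', c', t')) (itab n lam (r' + 1, 1, t'))
      (itab n lam (r' + 1, c', t')) i j → S i j)
    (hrow : ∀ i, S i (i + 1) →
      i + 1 = itab n lam (r + 1, 1, t) ∨ i + 1 = itab n lam (r' + 1, 1, t'))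
    {i j : ℕ} (hi : 1 ≤ i) (hij : i < j) (hj : j ≤ n) (hinv : w j < w i) : S i j := by
  obtain ⟨hTab, -, ⟨-, wA, -, hwA, -⟩, ⟨-, wB, -, hwB, -⟩, hleast⟩ := hG
  have hbij := bijOn_itab hTab hw
  obtain ⟨z, hz, hzinv⟩ := exists_perm_of_inversions n S htrans hcotrans
  have hperm : PermOf l n lam (fun x => z (itab n lam x)) z := ⟨hz, fun _ _ => rfl⟩
  have hzTab : IsTab l n lam fun x => z (itab n lam x) :=
    Set.BijOn.comp (g := z) (Equiv.bijOn z fun i => hz.mem_Icc_iff i) hbij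
  have hzRow : RowStrict l lam fun x => z (itab n lam x) := by
    intro a b s h1 h2
    have hm1 := hbij.mapsTo h1
    have hm2 := hbij.mapsTo h2
    have e1 := itab_eq_add (n := n) (lam := lam) a b s
    have e2 := itab_eq_add (n := n) (lam := lam) a (b + 1) s
    have hsucc : itab n lam (a, b + 1, s) = itab n lam (a, b, s) + 1 := by omega
    have hb : 1 ≤ b := h1.2.1
    have first : ∀ {r c t : ℕ}, IsGarnir l lam r c t →
        itab n lam (a, b + 1, s) ≠ itab n lam (r + 1, 1, t) := by
      intro r c t hC he
      have h3 : c ≤ lam t (r + 1) := hC.2.2.2.2.2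
      have h4 : 1 ≤ c := hC.2.2.1
      have := hbij.injOn h2 (x₂ := (r + 1, 1, t))
        ⟨by simp, by simp, hC.1.2.2.1, hC.1.2.2.2.1, by dsimp only; omega⟩ he
      simp only [Prod.mk.injEq] at this
      omega
    by_contra hc
    have hne : z (itab n lam (a, b, s)) ≠ z (itab n lam (a, b + 1, s)) := by
      rw [z.injective.ne_iff]
      omega
    have hS := (hzinv _ _ hm1.1 (by omega) hm2.2).1 (lt_of_le_of_ne (not_lt.1 hc) hne.symm)
    rw [hsucc] at hS
    have hAf := first hA
    have hBf := first hB
    rw [hsucc] at hAf hBf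
    exact (hrow _ hS).elim hAf hBf
  have hzA : TabGe l n lam (fun x => z (itab n lam x)) (gtab n lam r c t) :=
    ⟨z, wA, hperm, hwA, (leftGe_iff hz hwA.1).2 fun i j hi hij hj h =>
      (hzinv i j hi hij hj).2 (hSA i j ((gtab_inversions hbij hA hwA hi hij hj).1 h))⟩
  have hzB : TabGe l n lam (fun x => z (itab n lam x)) (gtab n lam r' c' t') :=
    ⟨z, wB, hperm, hwB, (leftGe_iff hz hwB.1).2 fun i j hi hij hj h =>
      (hzinv i j hi hij hj).2 (hSB i j ((gtab_inversions hbij hB hwB hi hij hj).1 h))⟩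
  have huniq : ∀ {T : MNode → ℕ} {v v' : Equiv.Perm ℕ}, PermOf l n lam T v →
      PermOf l n lam T v' → ∀ k, 1 ≤ k → k ≤ n → v k = v' k := by
    intro T v v' hv hv' k hk hk'
    obtain ⟨x, hx, rfl⟩ := hbij.surjOn (show k ∈ Set.Icc 1 n from ⟨hk, hk'⟩)
    rw [hv.2 x hx, hv'.2 x hx]
  obtain ⟨z', w', hz', hw', hge⟩ := hleast _ hzTab hzRow hzA hzB
  have := (leftGe_iff hz'.1 hw'.1).1 hge i j hi hij hj
  rw [huniq hw' hw i hi (by omega), huniq hw' hw j (by omega) hj,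
    huniq hz' hperm i hi (by omega), huniq hz' hperm j (by omega) hj] at this
  exact (hzinv i j hi hij hj).1 (this hinv)

theorem IsJoin.symm {r c t r' c' t' : ℕ} {G : MNode → ℕ}
    (hG : IsJoin l n lam r c t r' c' t' G) : IsJoin l n lam r' c' t' r c t G :=
  ⟨hG.1, hG.2.1, hG.2.2.2.1, hG.2.2.1, fun T h1 h2 h3 h4 => hG.2.2.2.2 T h1 h2 h4 h3⟩

theorem join_avoids321_of_disjoint {r c t r' c' t' : ℕ}
    (hA : IsGarnir l lam r c t) (hB : IsGarnir l lam r' c' t') {G : MNode → ℕ}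
    (hG : IsJoin l n lam r c t r' c' t' G)
    (hdisj : belt lam r c t ∩ belt lam r' c' t' = ∅) {w : Equiv.Perm ℕ}
    (hw : PermOf l n lam G w) : Avoids321 n w := by
  have hbij := bijOn_itab hG.1 hw
  have hlt := itab_garnir_lt (n := n) hA
  have hlt' := itab_garnir_lt (n := n) hB
  have hpos := hbij.mapsTo hA.1
  have hle := hbij.mapsTo hA.2
  have hpos' := hbij.mapsTo hB.1
  have hle' := hbij.mapsTo hB.2
  have hnum : ∀ k, ¬ ((itab n lam (r, c, t) ≤ k ∧ k ≤ itab n lam (r + 1, c, t)) ∧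
      (itab n lam (r', c', t') ≤ k ∧ k ≤ itab n lam (r' + 1, c', t'))) := by
    rintro k ⟨h1, h2⟩
    obtain ⟨x, hx, rfl⟩ := hbij.surjOn
      (show k ∈ Set.Icc 1 n from ⟨hpos.1.trans h1.1, h1.2.trans hle.2⟩)
    have hmem : ∀ {r c t : ℕ}, IsGarnir l lam r c t → itab n lam (r, c, t) ≤ itab n lam x →
        itab n lam x ≤ itab n lam (r + 1, c, t) → x ∈ belt lam r c t := by
      intro r c t hC h3 h4
      obtain ⟨hY, hX⟩ := mem_belt_iff hbij hC hx
      rcases lt_or_ge (itab n lam x) (itab n lam (r + 1, 1, t)) with h | h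
      · obtain ⟨rfl, rfl, hc⟩ := hX.2 ⟨h3, h⟩
        exact Or.inl ⟨rfl, rfl, hc, hx.2.2.2.2⟩
      · exact Or.inr (hY.2 ⟨h, h4⟩)
    exact hdisj.subset ⟨hmem hA h1.1 h1.2, hmem hB h2.1 h2.2⟩
  have hsep : itab n lam (r + 1, c, t) < itab n lam (r', c', t') ∨
      itab n lam (r' + 1, c', t') < itab n lam (r, c, t) := by
    have g1 := hnum (itab n lam (r, c, t))
    have g2 := hnum (itab n lam (r', c', t'))
    omega
  clear hnum
  let S : ℕ → ℕ → Prop := fun i j =>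
    BlockInv (itab n lam (r, c, t)) (itab n lam (r + 1, 1, t)) (itab n lam (r + 1, c, t)) i j ∨
    BlockInv (itab n lam (r', c', t')) (itab n lam (r' + 1, 1, t'))
      (itab n lam (r' + 1, c', t')) i j
  refine avoids321_of_inversions S (fun i j hi hij hj => join_inversions_le hA hB hG hw S
    ?_ ?_ (fun _ _ => Or.inl) (fun _ _ => Or.inr) ?_ hi hij hj) ?_
  all_goals
    simp only [S, BlockInv]
    omega

theorem join_avoids321_of_same_row {r c t c' : ℕ}
    (hA : IsGarnir l lam r c t) (hB : IsGarnir l lam r c' t) {G : MNode → ℕ}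
    (hG : IsJoin l n lam r c t r c' t G) {w : Equiv.Perm ℕ}
    (hw : PermOf l n lam G w) : Avoids321 n w := by
  let S : ℕ → ℕ → Prop := BlockInv (min (itab n lam (r, c, t)) (itab n lam (r, c', t)))
    (itab n lam (r + 1, 1, t)) (max (itab n lam (r + 1, c, t)) (itab n lam (r + 1, c', t)))
  refine avoids321_of_inversions S (fun i j hi hij hj => join_inversions_le hA hB hG hw S
    ?_ ?_ ?_ ?_ ?_ hi hij hj) ?_
  all_goals
    simp only [S, BlockInv]
    omega

/-- When the second belt starts inside the lower row of the first one, the join has only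
the inversions of the two Garnir tableaux and those forced by transitivity. -/
theorem join_inversions_of_consecutive_rows {r c t c' : ℕ}
    (hA : IsGarnir l lam r c t) (hB : IsGarnir l lam (r + 1) c' t) (hc : c' ≤ c)
    {G : MNode → ℕ} (hG : IsJoin l n lam r c t (r + 1) c' t G) {w : Equiv.Perm ℕ}
    (hw : PermOf l n lam G w) {i j k : ℕ} (hi : 1 ≤ i) (hij : i < j) (hjk : j < k) (hk : k ≤ n)
    (h1 : w j < w i) (h2 : w k < w j) :
    BlockInv (itab n lam (r, c, t)) (itab n lam (r + 1, 1, t)) (itab n lam (r + 1, c, t)) i j ∧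
    BlockInv (itab n lam (r + 1, c', t)) (itab n lam (r + 1 + 1, 1, t))
      (itab n lam (r + 1 + 1, c', t)) j k := by
  have hlt := itab_garnir_lt (n := n) hA
  have hlt' := itab_garnir_lt (n := n) hB
  have hrow := itab_succ_row (n := n) (lam := lam) (show 1 ≤ r + 1 by omega) t
  have e1 := itab_eq_add (n := n) (lam := lam) (r + 1) c t
  have e2 := itab_eq_add (n := n) (lam := lam) (r + 1) c' t
  have e3 := itab_eq_add (n := n) (lam := lam) (r + 1) 1 t
  have e4 := itab_eq_add (n := n) (lam := lam) (r + 1 + 1) 1 t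
  have hc1 : 1 ≤ c' := hB.1.2.1
  have hc2 : c ≤ lam t (r + 1) := hA.2.2.2.2.2
  have hord : itab n lam (r + 1, 1, t) ≤ itab n lam (r + 1, c', t) ∧
      itab n lam (r + 1, c', t) ≤ itab n lam (r + 1, c, t) ∧
      itab n lam (r + 1, c, t) < itab n lam (r + 1 + 1, 1, t) := by omega
  clear hrow e1 e2 e3 e4
  let S : ℕ → ℕ → Prop := fun i j =>
    BlockInv (itab n lam (r, c, t)) (itab n lam (r + 1, 1, t)) (itab n lam (r + 1, c, t)) i j ∨
    BlockInv (itab n lam (r + 1, c', t)) (itab n lam (r + 1 + 1, 1, t))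
      (itab n lam (r + 1 + 1, c', t)) i j ∨
    (itab n lam (r, c, t) ≤ i ∧ i < itab n lam (r + 1, 1, t) ∧
      itab n lam (r + 1 + 1, 1, t) ≤ j ∧ j ≤ itab n lam (r + 1 + 1, c', t))
  have hS : ∀ i j, 1 ≤ i → i < j → j ≤ n → w j < w i → S i j := by
    refine fun i j hi hij hj => join_inversions_le hA hB hG hw S
      ?_ ?_ (fun _ _ => Or.inl) (fun _ _ h => Or.inr (Or.inl h)) ?_ hi hij hj
    all_goals
      simp only [S, BlockInv]
      omega
  have hS1 := hS i j hi hij (by omega) h1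
  have hS2 := hS j k (by omega) hjk hk h2
  simp only [S, BlockInv] at hS1 hS2 ⊢
  omega

/-- A chain of two inversions of the join involves an inversion of each Garnir tableau. -/
theorem join_chain {r c t r' c' t' : ℕ}
    (hA : IsGarnir l lam r c t) (hB : IsGarnir l lam r' c' t') {G : MNode → ℕ}
    (hG : IsJoin l n lam r c t r' c' t' G) {w wA wB : Equiv.Perm ℕ}
    (hw : PermOf l n lam G w) (hwA : PermOf l n lam (gtab n lam r c t) wA)
    (hwB : PermOf l n lam (gtab n lam r' c' t') wB)
    {i j k : ℕ} (hi : 1 ≤ i) (hij : i < j) (hjk : j < k) (hk : k ≤ n)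
    (h1 : w j < w i) (h2 : w k < w j) :
    (wA j < wA i ∨ wA k < wA j) ∧ (wB j < wB i ∨ wB k < wB j) := by
  have hbij := bijOn_itab hG.1 hw
  have iA1 := gtab_inversions hbij hA hwA hi hij (by omega)
  have iA2 := gtab_inversions hbij hA hwA (by omega) hjk hk
  have iB1 := gtab_inversions hbij hB hwB hi hij (by omega)
  have iB2 := gtab_inversions hbij hB hwB (by omega) hjk hk
  by_cases hdisj : belt lam r c t ∩ belt lam r' c' t' = ∅
  · exact (join_avoids321_of_disjoint hA hB hG hdisj hw i j k hi hij hjk hk h1 h2).elim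
  obtain ⟨⟨a, b, s⟩, hxA, hxB⟩ := Set.nonempty_iff_ne_empty.2 hdisj
  simp only [belt, Set.mem_ofPred_eq] at hxA hxB
  obtain rfl : t = t' := by omega
  rcases (by omega : r = r' ∨ (r' = r + 1 ∧ c' ≤ c) ∨ (r = r' + 1 ∧ c ≤ c')) with
    rfl | ⟨rfl, hc⟩ | ⟨rfl, hc⟩
  · exact (join_avoids321_of_same_row hA hB hG hw i j k hi hij hjk hk h1 h2).elim
  · have := join_inversions_of_consecutive_rows hA hB hc hG hw hi hij hjk hk h1 h2
    exact ⟨Or.inl (iA1.2 this.1), Or.inr (iB2.2 this.2)⟩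
  · have := join_inversions_of_consecutive_rows hB hA hc hG.symm hw hi hij hjk hk h1 h2
    exact ⟨Or.inr (iA2.2 this.2), Or.inl (iB1.2 this.1)⟩

theorem join_left_factor_avoids321 {r c t r' c' t' : ℕ}
    (hA : IsGarnir l lam r c t) (hB : IsGarnir l lam r' c' t') {G : MNode → ℕ}
    (hG : IsJoin l n lam r c t r' c' t' G) {z : Equiv.Perm ℕ}
    (hz : ∀ x ∈ diag l lam, G x = z (gtab n lam r c t x)) : Avoids321 n z := by
  obtain ⟨w, wA, hw, hwA, hge⟩ := hG.2.2.1
  obtain ⟨-, wB, -, hwB, -⟩ := hG.2.2.2.1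
  have hbij := bijOn_itab hG.1 hw
  refine avoids321_of_left_factor (v := w) hwA.1 ?_ ((leftGe_iff hw.1 hwA.1).1 hge) ?_
  · intro i hi hi'
    obtain ⟨x, hx, rfl⟩ := hbij.surjOn (show i ∈ Set.Icc 1 n from ⟨hi, hi'⟩)
    rw [hw.2 x hx, hwA.2 x hx, hz x hx]
  · intro i j k hi hij hjk hk h1 h2 h3 h4
    have := (join_chain hA hB hG hw hwA hwB hi hij hjk hk h1 h2).1
    omega

end Tableaux

/-- Let `A = (r,c,t)` and `B = (r',c',t')` be distinct Garnir nodes of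
`λ` and let `G = g^{A,B}` be the join of `g^A` and `g^B`.  Then: (1) if the Garnir belts
are disjoint, `w^{G}` is 321-avoiding; (2) if `r = r'` and `t = t'`, `w^{G}` is
321-avoiding; (3) if `w^A, w^B ∈ S_n` satisfy `G = w^A g^A = w^B g^B`, then `w^A` and
`w^B` are 321-avoiding. -/
theorem stmt7 (l n : ℕ) (hl : 1 ≤ l) (lam : ℕ → ℕ → ℕ) (hMP : IsMP l n lam)
    (r c t r' c' t' : ℕ)
    (hA : IsGarnir l lam r c t) (hB : IsGarnir l lam r' c' t')
    (hne : (r, c, t) ≠ (r', c', t'))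
    (G : MNode → ℕ) (hG : IsJoin l n lam r c t r' c' t' G) :
    ((belt lam r c t ∩ belt lam r' c' t' = ∅) →
        ∀ w : Equiv.Perm ℕ, PermOf l n lam G w → Avoids321 n w) ∧
    ((r = r' ∧ t = t') →
        ∀ w : Equiv.Perm ℕ, PermOf l n lam G w → Avoids321 n w) ∧
    (∀ wA wB : Equiv.Perm ℕ, FixOut n wA → FixOut n wB →
      (∀ x ∈ diag l lam, G x = wA (gtab n lam r c t x)) →
      (∀ x ∈ diag l lam, G x = wB (gtab n lam r' c' t' x)) →
      Avoids321 n wA ∧ Avoids321 n wB) := by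
  refine ⟨fun hdisj w hw => join_avoids321_of_disjoint hA hB hG hdisj hw, ?_,
    fun wA wB _ _ h1 h2 => ⟨join_left_factor_avoids321 hA hB hG h1,
      join_left_factor_avoids321 hB hA hG.symm h2⟩⟩
  rintro ⟨rfl, rfl⟩ w hw
  exact join_avoids321_of_same_row hA hB hG hw
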